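/- arXiv:2211.11866 — 4 statements merged into one kernel-verified Lean document; each statement's English description precedes it below -/
import Mathlib

section
/- Let T > 0 and let (𝓜, u) be a complete conformal Ricci flow spacetime in the ambient space ℂ × (0,T). Fix s ∈ (0,T) and suppose U ⊆ 𝓜_s is a connected subset. Then the vanishing time is constant on U: for all x, y ∈ U, T_{(x,s)} = T_{(y,s)}. -/
open Set MeasureTheory Filter Metric

/-- The Euclidean Laplacian of `f : ℂ → ℝ` at `z`, i.e. `∂²f/∂x² + ∂²f/∂y²`. -/
noncomputable def lap (f : ℂ → ℝ) (z : ℂ) : ℝ :=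
  iteratedFDeriv ℝ 2 f z ![1, 1] + iteratedFDeriv ℝ 2 f z ![Complex.I, Complex.I]

/-- The time-timeSlice of a spacetime `M ⊆ ℂ × ℝ` at time `t`. -/
def timeSlice (M : Set (ℂ × ℝ)) (t : ℝ) : Set ℂ := {z | (z, t) ∈ M}

/-- The conformal distance on `Ω` induced by a conformal factor `v`: the infimum of
`v`-lengths of `C¹` paths in `Ω` joining `x` to `y`. -/
noncomputable def confDist (v : ℂ → ℝ) (Ω : Set ℂ) (x y : ℂ) : ℝ :=
  sInf {L : ℝ | ∃ γ : ℝ → ℂ, ContDiffOn ℝ 1 γ (Icc 0 1) ∧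
    (∀ s ∈ Icc (0:ℝ) 1, γ s ∈ Ω) ∧ γ 0 = x ∧ γ 1 = y ∧
    L = ∫ s in (0:ℝ)..1, Real.sqrt (v (γ s)) * ‖derivWithin γ (Icc 0 1) s‖}

/-- The conformal ball of centre `p` and radius `ρ` in `Ω` for the metric `v|dz|²`. -/
def confBall (v : ℂ → ℝ) (Ω : Set ℂ) (p : ℂ) (ρ : ℝ) : Set ℂ :=
  {z ∈ connectedComponentIn Ω p | confDist v Ω p z < ρ}

/-- The conformal metric `v|dz|²` is complete on `Ω`: every connected component of `Ω` is a
complete metric space with respect to the induced distance `confDist v Ω`. -/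
def ConfComplete (v : ℂ → ℝ) (Ω : Set ℂ) : Prop :=
  ∀ x₀ ∈ Ω, ∀ x : ℕ → ℂ, (∀ n, x n ∈ connectedComponentIn Ω x₀) →
    (∀ ε : ℝ, 0 < ε → ∃ N : ℕ, ∀ m ≥ N, ∀ n ≥ N, confDist v Ω (x m) (x n) < ε) →
    ∃ l ∈ connectedComponentIn Ω x₀,
      Tendsto (fun n => confDist v Ω (x n) l) atTop (nhds 0)

/-- A conformal Ricci flow spacetime in the ambient space `ℂ × (0,T)`:
`M` is a connected open subset of `ℂ × (0,T)` with non-empty time-slices, and `u` is a smooth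
positive conformal factor on `M` solving the logarithmic fast diffusion equation
`∂u/∂t = Δ log u`. -/
structure ConfRFS (T : ℝ) (M : Set (ℂ × ℝ)) (u : ℂ → ℝ → ℝ) : Prop where
  sub : M ⊆ {p : ℂ × ℝ | p.2 ∈ Ioo 0 T}
  opn : IsOpen M
  conn : IsConnected M
  nonempty : ∀ t ∈ Ioo (0:ℝ) T, (timeSlice M t).Nonempty
  pos : ∀ p ∈ M, 0 < u p.1 p.2
  smooth : ContDiffOn ℝ (⊤ : ℕ∞) (fun p : ℂ × ℝ => u p.1 p.2) M
  lfde : ∀ p ∈ M, deriv (u p.1) p.2 = lap (fun z => Real.log (u z p.2)) p.1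

/-- A conformal Ricci flow spacetime is complete if the metric `u(·,t)|dz|²` is complete on the
timeSlice `M_t` for every `t ∈ (0,T)`. -/
def ConfRFSComplete (T : ℝ) (M : Set (ℂ × ℝ)) (u : ℂ → ℝ → ℝ) : Prop :=
  ∀ t ∈ Ioo (0:ℝ) T, ConfComplete (fun z => u z t) (timeSlice M t)

/-- There is a time-preserving path in `M` from time `s` to the point `(z,t)`. -/
def TimePreservingFrom (M : Set (ℂ × ℝ)) (s : ℝ) (z : ℂ) (t : ℝ) : Prop :=
  ∃ γ : ℝ → ℂ, ContinuousOn γ (Icc s t) ∧ (∀ r ∈ Icc s t, (γ r, r) ∈ M) ∧ γ t = z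

/-- The hindsight function of a spacetime `M`. -/
noncomputable def hindsight (M : Set (ℂ × ℝ)) (z : ℂ) (t : ℝ) : ℝ :=
  sInf {s : ℝ | 0 < s ∧ s ≤ t ∧ TimePreservingFrom M s z t}

/-- A spacetime is initially determined if its hindsight function vanishes identically. -/
def InitiallyDetermined (M : Set (ℂ × ℝ)) : Prop :=
  ∀ p ∈ M, hindsight M p.1 p.2 = 0

/-- A spacetime in `ℂ × (0,T)` is expanding if worldlines persist until the final time. -/
def Expanding (T : ℝ) (M : Set (ℂ × ℝ)) : Prop :=
  ∀ (z : ℂ) (t t' : ℝ), (z, t) ∈ M → t ≤ t' → t' < T → (z, t') ∈ M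

/-- An expanding spacetime is continuous if each timeSlice is the interior of the intersection of
all later slices. -/
def ContinuousSpacetime (T : ℝ) (M : Set (ℂ × ℝ)) : Prop :=
  ∀ s ∈ Ioo (0:ℝ) T, timeSlice M s = interior (⋂ t ∈ Ioo s T, timeSlice M t)

/-- The vanishing time of the point `(z,t)`: the supremum of the connected component containing
`t` of the set of times at which `z` belongs to the spacetime. -/
noncomputable def vanishTime (M : Set (ℂ × ℝ)) (z : ℂ) (t : ℝ) : ℝ :=
  sSup (connectedComponentIn {r : ℝ | (z, r) ∈ M} t)

/-- Necessary second order condition at a local maximum of a sum of two functions. -/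
theorem deriv_deriv_add_nonpos_of_isLocalMax {f g : ℝ → ℝ} {x : ℝ} (hf : ContDiffAt ℝ 2 f x)
    (hg : ContDiffAt ℝ 2 g x) (hmax : IsLocalMax (fun t => f t + g t) x) :
    deriv (deriv f) x + deriv (deriv g) x ≤ 0 := by
  have hsum : deriv (fun t => f t + g t) =ᶠ[nhds x] fun t => deriv f t + deriv g t := by
    filter_upwards [hf.eventually (by simp), hg.eventually (by simp)] with t hft hgt
    exact deriv_fun_add (hft.differentiableAt (by simp)) (hgt.differentiableAt (by simp))
  have hdf : DifferentiableAt ℝ (deriv f) x :=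
    (hf.derivWithin (m := 1) (by norm_num)).differentiableAt (by simp)
  have hdg : DifferentiableAt ℝ (deriv g) x :=
    (hg.derivWithin (m := 1) (by norm_num)).differentiableAt (by simp)
  have hsecond : deriv (deriv fun t => f t + g t) x = deriv (deriv f) x + deriv (deriv g) x := by
    rw [hsum.deriv_eq, deriv_fun_add hdf hdg]
  rw [← hsecond]
  by_contra! hpos
  have hmin : IsLocalMin (fun t => f t + g t) x :=
    isLocalMin_of_deriv_deriv_pos hpos hmax.deriv_eq_zero (hf.continuousAt.add hg.continuousAt)
  have hconst : (fun t => f t + g t) =ᶠ[nhds x] fun _ => f x + g x := by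
    filter_upwards [hmax, hmin] with t h₁ h₂
    exact le_antisymm h₁ h₂
  have hzero : deriv (deriv fun t => f t + g t) x = 0 := by
    rw [hconst.deriv.deriv_eq]
    simp
  exact hpos.ne' hzero

/-- The second derivative along a line is a value of the second Fréchet derivative. -/
theorem deriv_deriv_comp_line {F : ℂ → ℝ} {z : ℂ} (hF : ContDiffAt ℝ 2 F z) (v : ℂ) :
    deriv (deriv fun τ : ℝ => F (z + τ • v)) 0 = iteratedFDeriv ℝ 2 F z ![v, v] := by
  have hline : ∀ τ : ℝ, HasDerivAt (fun τ : ℝ => z + τ • v) v τ := fun τ => by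
    simpa using ((hasDerivAt_id τ).smul_const v).const_add z
  have hcont : Tendsto (fun τ : ℝ => z + τ • v) (nhds 0) (nhds z) := by
    simpa using (hline 0).continuousAt.tendsto
  have hfirst : deriv (fun τ : ℝ => F (z + τ • v)) =ᶠ[nhds 0]
      fun τ : ℝ => fderiv ℝ F (z + τ • v) v := by
    filter_upwards [hcont.eventually (hF.eventually (by simp))] with τ hτ
    exact ((hτ.differentiableAt (by simp)).hasFDerivAt.comp_hasDerivAt τ (hline τ)).deriv
  have hdF : DifferentiableAt ℝ (fderiv ℝ F) z :=
    (hF.fderiv_right (m := 1) (by norm_num)).differentiableAt (by simp)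
  have hfd : HasFDerivAt (fderiv ℝ F) (fderiv ℝ (fderiv ℝ F) z) (z + (0 : ℝ) • v) := by
    rw [zero_smul, add_zero]
    exact hdF.hasFDerivAt
  have hsecond : HasDerivAt (fun τ : ℝ => fderiv ℝ F (z + τ • v) v)
      (fderiv ℝ (fderiv ℝ F) z v v) 0 := by
    have h := (ContinuousLinearMap.apply ℝ ℝ v).hasFDerivAt.comp_hasDerivAt (0 : ℝ)
      (hfd.comp_hasDerivAt (0 : ℝ) (hline 0))
    exact h
  rw [hfirst.deriv_eq, iteratedFDeriv_two_apply, hsecond.deriv]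
  rfl

theorem deriv_deriv_log_quadratic {α a : ℝ} (hα : 0 < α) :
    deriv (deriv fun τ : ℝ => Real.log (α - 2 * a * τ - τ ^ 2)) 0
      = (-2 * α - 4 * a ^ 2) / α ^ 2 := by
  have hquad : ∀ τ : ℝ, HasDerivAt (fun τ : ℝ => α - 2 * a * τ - τ ^ 2) (-2 * a - 2 * τ) τ := by
    intro τ
    have h := (((hasDerivAt_id' τ).const_mul (2 * a)).const_sub α).sub (hasDerivAt_pow 2 τ)
    exact h.congr_deriv (by norm_num)
  have hpos : ∀ᶠ τ : ℝ in nhds 0, 0 < α - 2 * a * τ - τ ^ 2 :=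
    (hquad 0).continuousAt.tendsto.eventually_const_lt (by simpa using hα)
  have hfirst : deriv (fun τ : ℝ => Real.log (α - 2 * a * τ - τ ^ 2)) =ᶠ[nhds 0]
      fun τ => (-2 * a - 2 * τ) / (α - 2 * a * τ - τ ^ 2) := by
    filter_upwards [hpos] with τ hτ
    exact ((hquad τ).log hτ.ne').deriv
  have hnum : HasDerivAt (fun τ : ℝ => -2 * a - 2 * τ) (-2) 0 := by
    simpa using ((hasDerivAt_id (0 : ℝ)).const_mul 2).const_sub (-2 * a)
  rw [hfirst.deriv_eq, (hnum.fun_div (hquad 0) (by simpa using hα.ne')).deriv]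
  congr 1 <;> ring

/-- If `G + log (ρ² - ‖· - y‖²)` has a local maximum at `z`, the Laplacian of `G` at `z`
is at most the negative of the Laplacian of the second summand. -/
theorem lap_le_of_isLocalMax {G : ℂ → ℝ} {y z : ℂ} {ρ : ℝ} (hG : ContDiffAt ℝ 2 G z)
    (hz : ‖z - y‖ ^ 2 < ρ ^ 2)
    (hmax : IsLocalMax (fun x => G x + Real.log (ρ ^ 2 - ‖x - y‖ ^ 2)) z) :
    lap G z ≤ 4 * ρ ^ 2 / (ρ ^ 2 - ‖z - y‖ ^ 2) ^ 2 := by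
  set α := ρ ^ 2 - ‖z - y‖ ^ 2 with hα
  have hα0 : 0 < α := by linarith
  have hdir : ∀ (v : ℂ) (a : ℝ),
      (∀ τ : ℝ, ρ ^ 2 - ‖z + τ • v - y‖ ^ 2 = α - 2 * a * τ - τ ^ 2) →
      iteratedFDeriv ℝ 2 G z ![v, v] ≤ (2 * α + 4 * a ^ 2) / α ^ 2 := by
    intro v a hv
    have hline : ContDiff ℝ 2 (fun τ : ℝ => z + τ • v) := by fun_prop
    have hf : ContDiffAt ℝ 2 (fun τ : ℝ => G (z + τ • v)) 0 :=
      ContDiffAt.comp (0 : ℝ) (by simpa using hG) hline.contDiffAt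
    have hg : ContDiffAt ℝ 2 (fun τ : ℝ => Real.log (α - 2 * a * τ - τ ^ 2)) 0 :=
      ContDiffAt.log (by fun_prop) (by simpa using hα0.ne')
    have hloc : IsLocalMax
        (fun τ : ℝ => G (z + τ • v) + Real.log (α - 2 * a * τ - τ ^ 2)) 0 := by
      have hcont : Tendsto (fun τ : ℝ => z + τ • v) (nhds 0) (nhds z) := by
        simpa using hline.continuous.tendsto 0
      filter_upwards [hcont.eventually hmax] with τ hτ
      rw [hv] at hτ
      simpa [← hα] using hτ
    have h := deriv_deriv_add_nonpos_of_isLocalMax hf hg hloc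
    rw [deriv_deriv_comp_line hG, deriv_deriv_log_quadratic hα0] at h
    have : (-2 * α - 4 * a ^ 2) / α ^ 2 = -((2 * α + 4 * a ^ 2) / α ^ 2) := by ring
    linarith
  have h₁ := hdir 1 (z - y).re fun τ => by
    simp only [hα, ← Complex.normSq_eq_norm_sq, Complex.normSq_apply]
    simp
    ring
  have h₂ := hdir Complex.I (z - y).im fun τ => by
    simp only [hα, ← Complex.normSq_eq_norm_sq, Complex.normSq_apply]
    simp
    ring
  have hnorm : ‖z - y‖ ^ 2 = (z - y).re ^ 2 + (z - y).im ^ 2 := by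
    rw [← Complex.normSq_eq_norm_sq, Complex.normSq_apply]
    ring
  calc lap G z ≤ (2 * α + 4 * (z - y).re ^ 2) / α ^ 2 + (2 * α + 4 * (z - y).im ^ 2) / α ^ 2 :=
        add_le_add h₁ h₂
    _ = 4 * ρ ^ 2 / α ^ 2 := by
        rw [← add_div]
        congr 1
        rw [hα, hnorm]
        ring

theorem HasDerivAt.nonneg_of_eventually_le_left {f : ℝ → ℝ} {f' x : ℝ} (hf : HasDerivAt f f' x)
    (hle : ∀ᶠ t in nhdsWithin x (Iio x), f t ≤ f x) : 0 ≤ f' := by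
  have hlim : Tendsto (slope f x) (nhdsWithin x (Iio x)) (nhds f') :=
    hf.tendsto_slope.mono_left (nhdsWithin_mono x fun t ht => ne_of_lt ht)
  refine ge_of_tendsto hlim ?_
  filter_upwards [hle, self_mem_nhdsWithin] with t ht hlt
  rw [slope_def_field]
  exact div_nonneg_of_nonpos (sub_nonpos.2 ht) (sub_nonpos.2 (le_of_lt hlt))

/-- Comparison with the barrier `A / (ρ(t)² - ‖z - y‖²)` on a disc whose radius `ρ(t)` shrinks
with speed `c`. -/
theorem ConfRFS.mul_le_of_shrinking_disc {T : ℝ} {M : Set (ℂ × ℝ)} {u : ℂ → ℝ → ℝ}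
    (hRF : ConfRFS T M u) {y : ℂ} {r₀ c t₀ t₁ σ A : ℝ} (hr₀ : 0 < r₀) (hc : 0 < c)
    (ht₀₁ : t₀ ≤ t₁) (ht₁ : t₁ ≤ σ)
    (hM : ∀ t ∈ Icc t₀ t₁, ∀ z : ℂ, ‖z - y‖ ≤ r₀ + c * (σ - t) → (z, t) ∈ M)
    (hA : 2 * (r₀ + c * (σ - t₀)) / c < A)
    (hinit : ∀ z : ℂ, ‖z - y‖ ≤ r₀ + c * (σ - t₀) →
      u z t₀ * ((r₀ + c * (σ - t₀)) ^ 2 - ‖z - y‖ ^ 2) < A)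
    {z : ℂ} (hz : ‖z - y‖ ≤ r₀ + c * (σ - t₁)) :
    u z t₁ * ((r₀ + c * (σ - t₁)) ^ 2 - ‖z - y‖ ^ 2) < A := by
  set ρ : ℝ → ℝ := fun t => r₀ + c * (σ - t) with hρ
  have hρpos : ∀ t ≤ t₁, 0 < ρ t := fun t ht => by
    have : 0 ≤ c * (σ - t) := mul_nonneg hc.le (by linarith)
    simp only [hρ]
    linarith
  set q : ℂ × ℝ → ℝ := fun p => u p.1 p.2 * (ρ p.2 ^ 2 - ‖p.1 - y‖ ^ 2) with hq
  set K : Set (ℂ × ℝ) := {p | p.2 ∈ Icc t₀ t₁ ∧ ‖p.1 - y‖ ≤ ρ p.2} with hK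
  have hρanti : ∀ t, t₀ ≤ t → ρ t ≤ ρ t₀ := fun t ht => by
    simp only [hρ]
    nlinarith
  have hKM : K ⊆ M := fun p hp => hM p.2 hp.1 p.1 hp.2
  have hKcomp : IsCompact K := by
    refine ((isCompact_closedBall y (ρ t₀)).prod (isCompact_Icc (a := t₀) (b := t₁))).of_isClosed_subset
      ?_ ?_
    · exact (isClosed_Icc.preimage continuous_snd).inter
        (isClosed_le (f := fun p : ℂ × ℝ => ‖p.1 - y‖) (g := fun p : ℂ × ℝ => ρ p.2)
          (by fun_prop) (by fun_prop))
    · rintro p ⟨hp, hpr⟩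
      exact ⟨by simpa [dist_eq_norm] using hpr.trans (hρanti _ hp.1), hp⟩
  have hucont : ContinuousOn (fun p : ℂ × ℝ => u p.1 p.2) M := hRF.smooth.continuousOn
  have hqcont : ContinuousOn q K := (hucont.mono hKM).mul (by fun_prop)
  have hmem : (z, t₁) ∈ K := ⟨⟨ht₀₁, le_rfl⟩, hz⟩
  obtain ⟨⟨x, t⟩, hxK, hmax⟩ := hKcomp.exists_isMaxOn ⟨_, hmem⟩ hqcont
  refine lt_of_le_of_lt (hmax hmem) ?_
  obtain ⟨⟨htl, htr⟩, hxr⟩ := hxK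
  simp only at htl htr hxr
  by_contra! hge
  have hxM : (x, t) ∈ M := hM t ⟨htl, htr⟩ x hxr
  have hu : 0 < u x t := hRF.pos _ hxM
  have hApos : 0 < A := lt_trans (by have := hρpos t₀ ht₀₁; positivity) hA
  have hρt := hρpos t htr
  have hD : 0 < ρ t ^ 2 - ‖x - y‖ ^ 2 :=
    (mul_pos_iff_of_pos_left hu).1 (hApos.trans_le hge)
  have hxr' : ‖x - y‖ < ρ t := lt_of_pow_lt_pow_left₀ 2 hρt.le (by linarith)
  have htl' : t₀ < t := by
    refine lt_of_le_of_ne htl ?_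
    rintro rfl
    exact absurd (hinit x hxr) (not_lt.2 hge)
  have hsmooth : ContDiffAt ℝ (⊤ : ℕ∞) (fun p : ℂ × ℝ => u p.1 p.2) (x, t) :=
    hRF.smooth.contDiffAt (hRF.opn.mem_nhds hxM)
  -- the spatial second order condition
  have hspace : lap (fun w => Real.log (u w t)) x
      ≤ 4 * ρ t ^ 2 / (ρ t ^ 2 - ‖x - y‖ ^ 2) ^ 2 := by
    have hslice : ContDiffAt ℝ 2 (fun w => u w t) x :=
      ContDiffAt.comp x (g := fun p : ℂ × ℝ => u p.1 p.2) (f := fun w : ℂ => (w, t))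
        (hsmooth.of_le (WithTop.coe_le_coe.2 (le_top : (2 : ℕ∞) ≤ ⊤))) (by fun_prop)
    refine lap_le_of_isLocalMax (hslice.log hu.ne') (by linarith) ?_
    have hnear : ∀ᶠ w in nhds x, ‖w - y‖ < ρ t :=
      (show Continuous fun w : ℂ => ‖w - y‖ by fun_prop).tendsto x |>.eventually_lt_const hxr'
    filter_upwards [hnear] with w hw
    have hwK : (w, t) ∈ K := ⟨⟨htl, htr⟩, hw.le⟩
    have hwu : 0 < u w t := hRF.pos _ (hKM hwK)
    have hwD : 0 < ρ t ^ 2 - ‖w - y‖ ^ 2 := by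
      have := pow_lt_pow_left₀ hw (norm_nonneg _) two_ne_zero
      linarith
    rw [← Real.log_mul hwu.ne' hwD.ne', ← Real.log_mul hu.ne' hD.ne']
    exact Real.log_le_log (mul_pos hwu hwD) (hmax hwK)
  -- the first order condition in time
  have htime : 0 ≤ lap (fun w => Real.log (u w t)) x * (ρ t ^ 2 - ‖x - y‖ ^ 2)
      + u x t * (2 * ρ t * (-c)) := by
    have hut : DifferentiableAt ℝ (u x) t :=
      DifferentiableAt.comp t (g := fun p : ℂ × ℝ => u p.1 p.2) (f := fun τ : ℝ => (x, τ))
        (hsmooth.differentiableAt (by simp)) (by fun_prop)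
    have hu' : HasDerivAt (u x) (lap (fun w => Real.log (u w t)) x) t := by
      rw [← hRF.lfde _ hxM]
      exact hut.hasDerivAt
    have hρ' : HasDerivAt ρ (-c) t := by
      have h := (((hasDerivAt_id' t).const_sub σ).const_mul c).const_add r₀
      exact h.congr_deriv (by ring)
    have hD' : HasDerivAt (fun τ => ρ τ ^ 2 - ‖x - y‖ ^ 2) (2 * ρ t * (-c)) t := by
      have h := (hρ'.fun_pow 2).sub_const (‖x - y‖ ^ 2)
      exact h.congr_deriv (by norm_num)
    refine (hu'.mul hD').nonneg_of_eventually_le_left ?_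
    filter_upwards [Ioo_mem_nhdsLT htl'] with τ hτ
    have hτK : (x, τ) ∈ K := by
      refine ⟨⟨hτ.1.le, hτ.2.le.trans htr⟩, hxr.trans ?_⟩
      have : c * (σ - t) ≤ c * (σ - τ) := mul_le_mul_of_nonneg_left (by linarith [hτ.2]) hc.le
      simp only [hρ]
      linarith
    exact hmax hτK
  have hDlap : lap (fun w => Real.log (u w t)) x * (ρ t ^ 2 - ‖x - y‖ ^ 2) ^ 2 ≤ 4 * ρ t ^ 2 := by
    rwa [le_div_iff₀ (by positivity)] at hspace
  have hkey : 2 * c * ρ t * q (x, t) ≤ 4 * ρ t ^ 2 := by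
    simp only [hq]
    nlinarith [mul_nonneg htime hD.le]
  have hcA : 2 * ρ t₀ < A * c := by rwa [div_lt_iff₀ hc] at hA
  have hρle := hρanti t htl
  have : 2 * c * ρ t * A ≤ 2 * c * ρ t * q (x, t) :=
    mul_le_mul_of_nonneg_left hge (by positivity)
  nlinarith

/-- On a disc shrinking with positive speed, a conformal Ricci flow is bounded at the final time
by a multiple of the inverse distance to the boundary of the disc. -/
theorem ConfRFS.exists_bound_of_shrinking_disc {T : ℝ} {M : Set (ℂ × ℝ)} {u : ℂ → ℝ → ℝ}
    (hRF : ConfRFS T M u) {y : ℂ} {r₀ c t₀ σ : ℝ} (hr₀ : 0 < r₀) (hc : 0 < c) (ht₀ : t₀ < σ)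
    (hM : ∀ t ∈ Ico t₀ σ, ∀ z : ℂ, ‖z - y‖ ≤ r₀ + c * (σ - t) → (z, t) ∈ M)
    (hMσ : ∀ z : ℂ, ‖z - y‖ < r₀ → (z, σ) ∈ M) :
    ∃ A : ℝ, ∀ z : ℂ, ‖z - y‖ < r₀ → u z σ * (r₀ ^ 2 - ‖z - y‖ ^ 2) ≤ A := by
  set R := r₀ + c * (σ - t₀) with hR
  have hucont : ContinuousOn (fun p : ℂ × ℝ => u p.1 p.2) M := hRF.smooth.continuousOn
  have hcont₀ : ContinuousOn (fun z : ℂ => u z t₀ * (R ^ 2 - ‖z - y‖ ^ 2)) (closedBall y R) := by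
    refine ContinuousOn.mul ?_ (by fun_prop)
    refine hucont.comp (f := fun z : ℂ => (z, t₀)) (by fun_prop) fun z hz => ?_
    exact hM t₀ ⟨le_rfl, ht₀⟩ z (by simpa [dist_eq_norm] using hz)
  obtain ⟨C, hC⟩ := (isCompact_closedBall y R).bddAbove_image hcont₀
  refine ⟨max (2 * R / c) C + 1, fun z hz => ?_⟩
  have hbound : ∀ t ∈ Ico t₀ σ,
      u z t * ((r₀ + c * (σ - t)) ^ 2 - ‖z - y‖ ^ 2) ≤ max (2 * R / c) C + 1 := by
    intro t ht
    have hct : 0 < c * (σ - t) := mul_pos hc (by linarith [ht.2])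
    refine (hRF.mul_le_of_shrinking_disc hr₀ hc ht.1 ht.2.le
      (fun τ hτ => hM τ ⟨hτ.1, hτ.2.trans_lt ht.2⟩) ?_ (fun x hx => ?_) (by linarith)).le
    · linarith [le_max_left (2 * R / c) C]
    · have := hC (mem_image_of_mem _ (show x ∈ closedBall y R by simpa [dist_eq_norm] using hx))
      linarith [le_max_right (2 * R / c) C]
  have hzM := hMσ z hz
  have hlim : Tendsto (fun t => u z t * ((r₀ + c * (σ - t)) ^ 2 - ‖z - y‖ ^ 2))
      (nhdsWithin σ (Iio σ)) (nhds (u z σ * (r₀ ^ 2 - ‖z - y‖ ^ 2))) := by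
    refine Tendsto.mul ?_ ?_
    · have h : ContinuousAt (fun t : ℝ => u z t) σ :=
        ContinuousAt.comp (g := fun p : ℂ × ℝ => u p.1 p.2) (f := fun t : ℝ => (z, t))
          (hucont.continuousAt (hRF.opn.mem_nhds hzM)) (by fun_prop)
      exact h.tendsto.mono_left nhdsWithin_le_nhds
    · have h : Continuous fun t => (r₀ + c * (σ - t)) ^ 2 - ‖z - y‖ ^ 2 := by fun_prop
      have h' := (h.tendsto σ).mono_left (nhdsWithin_le_nhds (s := Iio σ))
      simpa using h'
  refine le_of_tendsto hlim ?_
  filter_upwards [Ico_mem_nhdsLT ht₀] with t ht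
  exact hbound t ht

/-- Two points of a connected component of an open set are joined by a `C¹` path. -/
theorem exists_contDiff_path {Ω : Set ℂ} (hΩ : IsOpen Ω) {x₀ x y : ℂ}
    (hx : x ∈ connectedComponentIn Ω x₀) (hy : y ∈ connectedComponentIn Ω x₀) :
    ∃ γ : ℝ → ℂ, ContDiff ℝ 1 γ ∧ (∀ s, γ s ∈ Ω) ∧ (∀ s ≤ 0, γ s = x) ∧ ∀ s, 1 ≤ s → γ s = y := by
  have hsub := connectedComponentIn_subset Ω x₀
  refine isPreconnected_connectedComponentIn.induction₂
    (fun x y => ∃ γ : ℝ → ℂ, ContDiff ℝ 1 γ ∧ (∀ s, γ s ∈ Ω) ∧ (∀ s ≤ 0, γ s = x) ∧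
      ∀ s, 1 ≤ s → γ s = y) ?_ ?_ ?_ hx hy
  · intro a ha
    obtain ⟨ε, hε, hball⟩ := Metric.isOpen_iff.1 hΩ a (hsub ha)
    filter_upwards [mem_nhdsWithin_of_mem_nhds (ball_mem_nhds a hε)] with b hb
    refine ⟨fun s => a + Real.smoothTransition s • (b - a), ?_, fun s => hball ?_, fun s hs => ?_,
      fun s hs => ?_⟩
    · exact contDiff_const.add (Real.smoothTransition.contDiff.smul contDiff_const)
    · rw [mem_ball, dist_eq_norm] at hb ⊢
      have h₀ := Real.smoothTransition.nonneg s
      have h₁ := Real.smoothTransition.le_one s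
      rw [add_sub_cancel_left, norm_smul, Real.norm_of_nonneg h₀]
      nlinarith [norm_nonneg (b - a)]
    · simp [Real.smoothTransition.zero_of_nonpos hs]
    · simp [Real.smoothTransition.one_of_one_le hs]
  · rintro a b c - - - ⟨γ₁, hγ₁, hm₁, hs₁, he₁⟩ ⟨γ₂, hγ₂, hm₂, hs₂, he₂⟩
    refine ⟨fun s => γ₁ (2 * s) + γ₂ (2 * s - 1) - b, ?_, fun s => ?_, fun s hs => ?_,
      fun s hs => ?_⟩
    · exact ((hγ₁.comp (by fun_prop)).add (hγ₂.comp (by fun_prop))).sub contDiff_const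
    · rcases le_total (2 * s) 1 with h | h
      · simpa [hs₂ (2 * s - 1) (by linarith)] using hm₁ (2 * s)
      · simpa [he₁ (2 * s) h] using hm₂ (2 * s - 1)
    · simp [hs₁ (2 * s) (by linarith), hs₂ (2 * s - 1) (by linarith)]
    · simp [he₁ (2 * s) (by linarith), he₂ (2 * s - 1) (by linarith)]
  · rintro a b - - ⟨γ, hγ, hm, hs₀, he⟩
    exact ⟨fun s => γ (1 - s), hγ.comp (by fun_prop), fun s => hm _,
      fun s hs => he _ (by linarith), fun s hs => hs₀ _ (by linarith)⟩

theorem confDist_le_of_forall_le {v : ℂ → ℝ} {Ω : Set ℂ} {γ : ℝ → ℂ} {C : ℝ}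
    (hγ : ContDiffOn ℝ 1 γ (Icc 0 1)) (hmem : ∀ s ∈ Icc (0 : ℝ) 1, γ s ∈ Ω)
    (hC : ∀ s ∈ Icc (0 : ℝ) 1, Real.sqrt (v (γ s)) * ‖derivWithin γ (Icc 0 1) s‖ ≤ C) :
    confDist v Ω (γ 0) (γ 1) ≤ C := by
  have hnonneg : BddBelow {L : ℝ | ∃ γ' : ℝ → ℂ, ContDiffOn ℝ 1 γ' (Icc 0 1) ∧
      (∀ s ∈ Icc (0 : ℝ) 1, γ' s ∈ Ω) ∧ γ' 0 = γ 0 ∧ γ' 1 = γ 1 ∧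
      L = ∫ s in (0 : ℝ)..1, Real.sqrt (v (γ' s)) * ‖derivWithin γ' (Icc 0 1) s‖} := by
    refine ⟨0, ?_⟩
    rintro L ⟨γ', -, -, -, -, rfl⟩
    exact intervalIntegral.integral_nonneg zero_le_one fun s _ => by positivity
  refine (csInf_le hnonneg ⟨γ, hγ, hmem, rfl, rfl, rfl⟩).trans ((le_abs_self _).trans ?_)
  have h := intervalIntegral.norm_integral_le_of_norm_le_const (a := 0) (b := 1) (C := C)
    (f := fun s => Real.sqrt (v (γ s)) * ‖derivWithin γ (Icc 0 1) s‖) fun s hs => by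
      rw [uIoc_of_le zero_le_one] at hs
      rw [Real.norm_of_nonneg (by positivity)]
      exact hC s ⟨hs.1.le, hs.2⟩
  simpa using h

/-- Points outside a compact Euclidean ball contained in `Ω` stay at a definite conformal distance
from its centre. -/
theorem le_confDist_of_closedBall_subset {v : ℂ → ℝ} {Ω : Set ℂ} (hΩ : IsOpen Ω)
    (hv : ContinuousOn v Ω) {x₀ x l : ℂ} {η m : ℝ} (hx : x ∈ connectedComponentIn Ω x₀)
    (hl : l ∈ connectedComponentIn Ω x₀) (hm : ∀ z ∈ closedBall l η, m ≤ v z)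
    (hxl : η ≤ ‖x - l‖) :
    Real.sqrt m * η ≤ confDist v Ω x l := by
  obtain ⟨γ₀, hγ₀, hm₀, hs₀, he₀⟩ := exists_contDiff_path hΩ hx hl
  refine le_csInf ⟨_, γ₀, hγ₀.contDiffOn, fun s _ => hm₀ s, hs₀ 0 le_rfl, he₀ 1 le_rfl, rfl⟩ ?_
  rintro L ⟨γ, hγ, hmem, rfl, rfl, rfl⟩
  have hγc : ContinuousOn γ (Icc 0 1) := hγ.continuousOn
  have hderc : ContinuousOn (derivWithin γ (Icc 0 1)) (Icc 0 1) :=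
    hγ.continuousOn_derivWithin (uniqueDiffOn_Icc zero_lt_one) le_rfl
  -- the last time at which the path is outside the open ball
  have hSclosed : IsClosed (Icc (0 : ℝ) 1 ∩ {s | η ≤ ‖γ s - γ 1‖}) :=
    (hγc.sub continuousOn_const).norm.preimage_isClosed_of_isClosed isClosed_Icc isClosed_Ici
  obtain ⟨a, ⟨⟨ha₀, ha₁⟩, haη⟩, hamax⟩ :=
    (isCompact_Icc.of_isClosed_subset hSclosed inter_subset_left).exists_isGreatest
      ⟨0, ⟨le_rfl, zero_le_one⟩, hxl⟩
  have hIcc : Icc a 1 ⊆ Icc 0 1 := Icc_subset_Icc_left ha₀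
  have hinside : ∀ s ∈ Ioc a 1, ‖γ s - γ 1‖ ≤ η := fun s hs => by
    by_contra! h
    exact absurd (hamax ⟨hIcc ⟨hs.1.le, hs.2⟩, h.le⟩) (not_le.2 hs.1)
  set F : ℝ → ℝ := fun s => Real.sqrt (v (γ s)) * ‖derivWithin γ (Icc 0 1) s‖ with hF
  have hFc : ContinuousOn F (Icc 0 1) := ((hv.comp hγc hmem).sqrt).mul hderc.norm
  have hint : IntervalIntegrable (derivWithin γ (Icc 0 1)) volume a 1 :=
    (hderc.mono hIcc).intervalIntegrable_of_Icc ha₁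
  have hftc : ∫ s in a..1, derivWithin γ (Icc 0 1) s = γ 1 - γ a := by
    refine intervalIntegral.integral_eq_sub_of_hasDerivAt_of_le ha₁ (hγc.mono hIcc) ?_ hint
    intro s hs
    have hs' : Icc (0 : ℝ) 1 ∈ nhds s := Icc_mem_nhds (ha₀.trans_lt hs.1) hs.2
    exact ((hγ.differentiableOn one_ne_zero s
      ⟨ha₀.trans hs.1.le, hs.2.le⟩).hasDerivWithinAt).hasDerivAt hs'
  have hlen : η ≤ ∫ s in a..1, ‖derivWithin γ (Icc 0 1) s‖ := by
    calc η ≤ ‖γ 1 - γ a‖ := by rw [norm_sub_rev]; exact haη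
      _ = ‖∫ s in a..1, derivWithin γ (Icc 0 1) s‖ := by rw [hftc]
      _ ≤ _ := intervalIntegral.norm_integral_le_integral_norm ha₁
  calc Real.sqrt m * η ≤ Real.sqrt m * ∫ s in a..1, ‖derivWithin γ (Icc 0 1) s‖ :=
        mul_le_mul_of_nonneg_left hlen (Real.sqrt_nonneg _)
    _ = ∫ s in a..1, Real.sqrt m * ‖derivWithin γ (Icc 0 1) s‖ :=
        (intervalIntegral.integral_const_mul _ _).symm
    _ ≤ ∫ s in a..1, F s := by
        refine intervalIntegral.integral_mono_on_of_le_Ioo ha₁ (hint.norm.const_mul _)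
          ((hFc.mono hIcc).intervalIntegrable_of_Icc ha₁) fun s hs => ?_
        refine mul_le_mul_of_nonneg_right (Real.sqrt_le_sqrt (hm _ ?_)) (norm_nonneg _)
        rw [mem_closedBall, dist_eq_norm]
        exact hinside s ⟨hs.1, hs.2.le⟩
    _ ≤ ∫ s in (0 : ℝ)..1, F s :=
        intervalIntegral.integral_mono_interval ha₀ ha₁ le_rfl
          (Eventually.of_forall fun s => by simp only [hF, Pi.zero_apply]; positivity)
          (hFc.intervalIntegrable_of_Icc zero_le_one)

/-- A complete conformal metric on an open set containing a disc, bounded there by a multiple of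
the inverse distance to the boundary circle, is defined on that circle too. -/
theorem ConfComplete.mem_of_mul_le {v : ℂ → ℝ} {Ω : Set ℂ} (hcomp : ConfComplete v Ω)
    (hΩ : IsOpen Ω) (hv : ContinuousOn v Ω) (hpos : ∀ z ∈ Ω, 0 < v z) {y w : ℂ} {A : ℝ}
    (hwy : w ≠ y) (hball : ∀ z : ℂ, ‖z - y‖ < ‖w - y‖ → z ∈ Ω)
    (hA : ∀ z : ℂ, ‖z - y‖ < ‖w - y‖ → v z * (‖w - y‖ ^ 2 - ‖z - y‖ ^ 2) ≤ A) : w ∈ Ω := by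
  by_contra hwΩ
  set r := ‖w - y‖ with hr
  have hr0 : 0 < r := norm_pos_iff.2 (sub_ne_zero.2 hwy)
  set P : ℝ → ℂ := fun p => w - (p ^ 2) • (w - y) with hP
  have hPcont : Continuous P := by fun_prop
  have hPnorm : ∀ p ∈ Ioc (0 : ℝ) 1, ‖P p - y‖ = (1 - p ^ 2) * r := fun p hp => by
    have : P p - y = (1 - p ^ 2) • (w - y) := by simp only [hP]; module
    rw [this, norm_smul, Real.norm_of_nonneg (by nlinarith [hp.1, hp.2])]
  have hPlt : ∀ p ∈ Ioc (0 : ℝ) 1, ‖P p - y‖ < r := fun p hp => by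
    rw [hPnorm p hp]
    nlinarith [mul_pos (pow_pos hp.1 2) hr0]
  have hPv : ∀ p ∈ Ioc (0 : ℝ) 1, Real.sqrt (v (P p)) * (p * r) ≤ Real.sqrt A := fun p hp => by
    have hpr : 0 < p * r := mul_pos hp.1 hr0
    have hvp := hpos _ (hball _ (hPlt p hp))
    rw [← Real.sqrt_sq hpr.le, ← Real.sqrt_mul hvp.le]
    refine Real.sqrt_le_sqrt ((mul_le_mul_of_nonneg_left ?_ hvp.le).trans (hA _ (hPlt p hp)))
    rw [hPnorm p hp]
    have hp2 : p ^ 2 ≤ 1 := pow_le_one₀ hp.1.le hp.2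
    nlinarith [mul_nonneg (mul_nonneg (sq_nonneg p) (sub_nonneg.2 hp2)) (sq_nonneg r)]
  have hdist : ∀ p ∈ Ioc (0 : ℝ) 1, ∀ q ∈ Ioc (0 : ℝ) 1,
      confDist v Ω (P p) (P q) ≤ 2 * Real.sqrt A * |q - p| := by
    intro p hp q hq
    have hmem : ∀ s ∈ Icc (0 : ℝ) 1, p + s * (q - p) ∈ Ioc (0 : ℝ) 1 := fun s hs => by
      have h := (convex_Ioc (0 : ℝ) 1) hp hq (sub_nonneg.2 hs.2) hs.1 (by ring)
      simp only [smul_eq_mul] at h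
      convert h using 1
      ring
    have h := confDist_le_of_forall_le (v := v) (Ω := Ω) (γ := fun s => P (p + s * (q - p)))
      (C := 2 * Real.sqrt A * |q - p|) ?_ (fun s hs => hball _ (hPlt _ (hmem s hs))) ?_
    · simpa using h
    · have : ContDiff ℝ 1 fun s : ℝ => P (p + s * (q - p)) := by
        simp only [hP]
        fun_prop
      exact this.contDiffOn
    · intro s hs
      have hps := hmem s hs
      have hder : HasDerivAt (fun s => P (p + s * (q - p)))
          (-((2 * (p + s * (q - p)) * (q - p)) • (w - y))) s := by
        have hlin : HasDerivAt (fun s : ℝ => p + s * (q - p)) (q - p) s := by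
          simpa using ((hasDerivAt_id' s).mul_const (q - p)).const_add p
        have h := ((hlin.fun_pow 2).smul_const (w - y)).const_sub w
        exact h.congr_deriv (by norm_num)
      rw [hder.hasDerivWithinAt.derivWithin (uniqueDiffOn_Icc zero_lt_one s hs), norm_neg,
        norm_smul, ← hr, Real.norm_eq_abs, abs_mul, abs_mul, abs_two, abs_of_pos hps.1]
      have := mul_le_mul_of_nonneg_right (hPv _ hps) (abs_nonneg (q - p))
      linarith
  set p : ℕ → ℝ := fun n => 1 / ((n : ℝ) + 1) with hp
  have hp01 : ∀ n, p n ∈ Ioc (0 : ℝ) 1 := fun n => by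
    refine ⟨by positivity, ?_⟩
    simp only [hp]
    rw [div_le_one (by positivity)]
    linarith [(Nat.cast_nonneg n : (0 : ℝ) ≤ n)]
  have hp0 : Tendsto p atTop (nhds 0) := tendsto_one_div_add_atTop_nhds_zero_nat
  have hy : y ∈ Ω := hball y (by simpa using hr0)
  have hxcomp : ∀ n, P (p n) ∈ connectedComponentIn Ω y := fun n => by
    have hpre : IsPreconnected (ball y r) := (convex_ball y r).isPreconnected
    refine hpre.subset_connectedComponentIn (mem_ball_self hr0) (fun z hz => hball z ?_) ?_
    · simpa [dist_eq_norm] using hz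
    · simpa [dist_eq_norm] using hPlt _ (hp01 n)
  obtain ⟨l, hl, hlim⟩ := hcomp y hy (fun n => P (p n)) hxcomp fun ε hε => by
    have hε' : 0 < ε / (2 * Real.sqrt A + 1) := by positivity
    obtain ⟨N, hN⟩ := Metric.cauchySeq_iff.1 hp0.cauchySeq _ hε'
    refine ⟨N, fun m hm n hn => (hdist _ (hp01 m) _ (hp01 n)).trans_lt ?_⟩
    have h := hN n hn m hm
    rw [Real.dist_eq, lt_div_iff₀ (by positivity)] at h
    nlinarith [abs_nonneg (p n - p m)]
  have hlΩ : l ∈ Ω := connectedComponentIn_subset Ω y hl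
  have hwl : 0 < ‖w - l‖ := norm_pos_iff.2 (sub_ne_zero.2 fun h => hwΩ (h ▸ hlΩ))
  obtain ⟨η₀, hη₀, hsub₀⟩ := Metric.nhds_basis_closedBall.mem_iff.1 (hΩ.mem_nhds hlΩ)
  set η := min η₀ (‖w - l‖ / 2) with hη
  have hηpos : 0 < η := lt_min hη₀ (by positivity)
  have hsub : closedBall l η ⊆ Ω := (closedBall_subset_closedBall (min_le_left _ _)).trans hsub₀
  obtain ⟨b, hb, hbmin⟩ := (isCompact_closedBall l η).exists_isMinOn
    ⟨l, mem_closedBall_self hηpos.le⟩ (hv.mono hsub)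
  have hlow : 0 < Real.sqrt (v b) * η := mul_pos (Real.sqrt_pos.2 (hpos b (hsub hb))) hηpos
  have hxw : Tendsto (fun n => ‖P (p n) - l‖) atTop (nhds ‖w - l‖) := by
    have h := ((hPcont.tendsto 0).comp hp0).sub_const l |>.norm
    simpa [hP, Function.comp_def] using h
  have hηlt : η < ‖w - l‖ := (min_le_right _ _).trans_lt (by linarith)
  obtain ⟨n, hn₁, hn₂⟩ :=
    ((hxw.eventually_const_lt hηlt).and (hlim.eventually_lt_const hlow)).exists
  exact absurd (le_confDist_of_closedBall_subset hΩ hv (hxcomp n) hl (fun z hz => hbmin hz)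
    hn₁.le) (not_le.2 hn₂)

section VanishTime

variable {T s a : ℝ} {M : Set (ℂ × ℝ)} {z : ℂ}

theorem le_vanishTime (hsub : M ⊆ {p : ℂ × ℝ | p.2 ∈ Ioo 0 T}) (hsa : s ≤ a)
    (h : ∀ r ∈ Icc s a, (z, r) ∈ M) : a ≤ vanishTime M z s := by
  refine le_csSup ⟨T, fun r hr => ?_⟩ ?_
  · have hr' : (z, r) ∈ M := connectedComponentIn_subset {r : ℝ | (z, r) ∈ M} s hr
    exact (hsub hr').2.le
  · exact isPreconnected_Icc.subset_connectedComponentIn (left_mem_Icc.2 hsa) h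
      (right_mem_Icc.2 hsa)

theorem vanishTime_le (hsub : M ⊆ {p : ℂ × ℝ | p.2 ∈ Ioo 0 T}) (hz : (z, s) ∈ M) :
    vanishTime M z s ≤ T := by
  refine csSup_le ⟨s, mem_connectedComponentIn hz⟩ fun r hr => ?_
  have hr' : (z, r) ∈ M := connectedComponentIn_subset {r : ℝ | (z, r) ∈ M} s hr
  exact (hsub hr').2.le

theorem mem_of_lt_vanishTime (hz : (z, s) ∈ M) (hsa : s ≤ a) (ha : a < vanishTime M z s) :
    (z, a) ∈ M := by
  have hs : s ∈ connectedComponentIn {r : ℝ | (z, r) ∈ M} s := mem_connectedComponentIn hz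
  obtain ⟨b, hb, hab⟩ := exists_lt_of_lt_csSup ⟨s, hs⟩ ha
  exact connectedComponentIn_subset {r : ℝ | (z, r) ∈ M} s
    (isPreconnected_connectedComponentIn.ordConnected.out hs hb ⟨hsa, hab.le⟩)

theorem lt_vanishTime (hM : IsOpen M) (hsub : M ⊆ {p : ℂ × ℝ | p.2 ∈ Ioo 0 T}) (hsa : s ≤ a)
    (h : ∀ r ∈ Icc s a, (z, r) ∈ M) : a < vanishTime M z s := by
  have hopen : IsOpen {r : ℝ | (z, r) ∈ M} := hM.preimage (by fun_prop)
  obtain ⟨ε, hε, hball⟩ := Metric.nhds_basis_closedBall.mem_iff.1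
    (hopen.mem_nhds (h a (right_mem_Icc.2 hsa)))
  refine (lt_add_of_pos_right a hε).trans_le (le_vanishTime hsub (by linarith) fun r hr => ?_)
  rcases le_total r a with hra | hra
  · exact h r ⟨hr.1, hra⟩
  · refine hball ?_
    rw [mem_closedBall, Real.dist_eq, abs_of_nonneg (by linarith)]
    linarith [hr.2]

theorem vanishTime_notMem (hM : IsOpen M) (hsub : M ⊆ {p : ℂ × ℝ | p.2 ∈ Ioo 0 T})
    (hz : (z, s) ∈ M) : (z, vanishTime M z s) ∉ M := by
  intro hmem
  have hs : s ≤ vanishTime M z s := le_vanishTime hsub le_rfl fun r hr => by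
    rwa [le_antisymm hr.2 hr.1]
  refine (lt_vanishTime hM hsub hs fun r hr => ?_).false
  rcases hr.2.lt_or_eq with h | rfl
  · exact mem_of_lt_vanishTime hz hr.1 h
  · exact hmem

theorem self_lt_vanishTime (hM : IsOpen M) (hsub : M ⊆ {p : ℂ × ℝ | p.2 ∈ Ioo 0 T})
    (hz : (z, s) ∈ M) : s < vanishTime M z s :=
  lt_vanishTime hM hsub le_rfl fun r hr => by rwa [le_antisymm hr.2 hr.1]

theorem lowerSemicontinuousOn_vanishTime (hM : IsOpen M)
    (hsub : M ⊆ {p : ℂ × ℝ | p.2 ∈ Ioo 0 T}) :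
    LowerSemicontinuousOn (fun z => vanishTime M z s) (timeSlice M s) := by
  intro z hz a ha
  have hmax : max a s < vanishTime M z s := max_lt ha (self_lt_vanishTime hM hsub hz)
  have hprod : ({z} : Set ℂ) ×ˢ Icc s (max a s) ⊆ M := by
    rintro ⟨x, r⟩ ⟨rfl, hr⟩
    exact mem_of_lt_vanishTime hz hr.1 (hr.2.trans_lt hmax)
  obtain ⟨V, W, hV, -, hzV, hW, hVW⟩ :=
    generalized_tube_lemma isCompact_singleton isCompact_Icc hM hprod
  filter_upwards [mem_nhdsWithin_of_mem_nhds (hV.mem_nhds (hzV rfl))] with x hx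
  exact (le_max_left a s).trans_lt
    (lt_vanishTime hM hsub (le_max_right _ _) fun r hr => hVW ⟨hx, hW hr⟩)

end VanishTime

/-- A complete spacetime has no point `w` at which the vanishing time, as a function on the slice
at time `s`, lies above a Lipschitz function that is strictly decreasing in the distance to `y`
and agrees with it at `w`. -/
theorem ConfRFS.not_exists_radial_touching {T : ℝ} {M : Set (ℂ × ℝ)} {u : ℂ → ℝ → ℝ}
    (hRF : ConfRFS T M u) (hcomp : ConfRFSComplete T M u) {s : ℝ} {y w : ℂ} {R₀ L : ℝ} {ψ : ℝ → ℝ}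
    (hslice : closedBall y R₀ ⊆ timeSlice M s) (hwy : w ≠ y) (hwR : ‖w - y‖ < R₀)
    (hwT : vanishTime M w s < T) (hL : 0 < L) (hψmono : StrictMono ψ)
    (hψlip : ∀ r r', r ≤ r' → ψ r' - ψ r ≤ L * (r' - r))
    (htouch : ∀ z ∈ closedBall y R₀,
      vanishTime M w s + ψ ‖w - y‖ ≤ vanishTime M z s + ψ ‖z - y‖) : False := by
  set σ := vanishTime M w s with hσ
  set r₀ := ‖w - y‖ with hr₀
  have hr₀pos : 0 < r₀ := norm_pos_iff.2 (sub_ne_zero.2 hwy)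
  have hball : ∀ z : ℂ, ‖z - y‖ ≤ R₀ → z ∈ closedBall y R₀ := fun z hz => by
    simpa [dist_eq_norm] using hz
  have hws : (w, s) ∈ M := hslice (hball w hwR.le)
  have hsσ : s < σ := self_lt_vanishTime hRF.opn hRF.sub hws
  have hwσ : (w, σ) ∉ M := vanishTime_notMem hRF.opn hRF.sub hws
  have hσpos : 0 < σ := lt_trans (hRF.sub hws).1 hsσ
  set c := 1 / (2 * L) with hc
  have hcpos : 0 < c := by positivity
  have hLc : L * c = 1 / 2 := by
    rw [hc]
    field_simp
  set t₀ := max s (σ - (R₀ - r₀) / c) with ht₀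
  have ht₀σ : t₀ < σ := max_lt hsσ (by
    have : 0 < (R₀ - r₀) / c := div_pos (by linarith) hcpos
    linarith)
  have hM : ∀ t ∈ Ico t₀ σ, ∀ z : ℂ, ‖z - y‖ ≤ r₀ + c * (σ - t) → (z, t) ∈ M := by
    intro t ht z hz
    have hσt : σ - t ≤ (R₀ - r₀) / c := by linarith [(le_max_right _ _).trans ht.1]
    rw [le_div_iff₀ hcpos] at hσt
    have hzD := hball z (by linarith)
    refine mem_of_lt_vanishTime (hslice hzD) ((le_max_left _ _).trans ht.1) ?_
    have hψz : ψ ‖z - y‖ - ψ r₀ ≤ L * (c * (σ - t)) := by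
      have h₁ := hψmono.monotone hz
      have h₂ := hψlip r₀ (r₀ + c * (σ - t)) (by nlinarith [ht.2])
      rw [add_sub_cancel_left] at h₂
      linarith
    rw [← mul_assoc, hLc] at hψz
    linarith [htouch z hzD, ht.2]
  have hMσ : ∀ z : ℂ, ‖z - y‖ < r₀ → (z, σ) ∈ M := by
    intro z hz
    have hzD := hball z (hz.le.trans hwR.le)
    exact mem_of_lt_vanishTime (hslice hzD) hsσ.le (by linarith [htouch z hzD, hψmono hz])
  obtain ⟨A, hA⟩ := hRF.exists_bound_of_shrinking_disc hr₀pos hcpos ht₀σ hM hMσ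
  refine hwσ ((hcomp σ ⟨hσpos, hwT⟩).mem_of_mul_le (hRF.opn.preimage (by fun_prop)) ?_
    (fun z hz => hRF.pos (z, σ) hz) hwy hMσ hA)
  exact ContinuousOn.comp (g := fun p : ℂ × ℝ => u p.1 p.2) (f := fun z : ℂ => (z, σ))
    hRF.smooth.continuousOn (by fun_prop) fun z hz => hz

/-- Nearby points of a time-slice have the same vanishing time. -/
theorem ConfRFS.vanishTime_le_of_mem_ball {T : ℝ} {M : Set (ℂ × ℝ)} {u : ℂ → ℝ → ℝ}
    (hT : 0 < T) (hRF : ConfRFS T M u) (hcomp : ConfRFSComplete T M u) {s ρ : ℝ} {p x y : ℂ}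
    (hp : closedBall p (4 * ρ) ⊆ timeSlice M s) (hx : x ∈ ball p ρ) (hy : y ∈ ball p ρ) :
    vanishTime M y s ≤ vanishTime M x s := by
  by_contra! hlt
  have hρ : 0 < ρ := pos_of_mem_ball hx
  have hslice : closedBall y (3 * ρ) ⊆ timeSlice M s :=
    (closedBall_subset_closedBall' (by linarith [mem_ball.1 hy])).trans hp
  have hxy : ‖x - y‖ < 2 * ρ := by
    rw [← dist_eq_norm]
    linarith [dist_triangle_right x y p, mem_ball.1 hx, mem_ball.1 hy]
  set ε := (vanishTime M y s - vanishTime M x s) / (2 * ρ) with hε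
  have hεpos : 0 < ε := div_pos (by linarith) (by linarith)
  set K := T / ρ with hK
  have hKpos : 0 < K := div_pos hT hρ
  set ψ : ℝ → ℝ := fun r => ε * r + K * max (r - 2 * ρ) 0 with hψ
  have hψmono : StrictMono ψ := fun r r' h => by
    have h₁ : max (r - 2 * ρ) 0 ≤ max (r' - 2 * ρ) 0 := max_le_max (by linarith) le_rfl
    simp only [hψ]
    nlinarith
  have hψlip : ∀ r r', r ≤ r' → ψ r' - ψ r ≤ (ε + K) * (r' - r) := fun r r' h => by
    have h₁ : max (r' - 2 * ρ) 0 ≤ max (r - 2 * ρ) 0 + (r' - r) :=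
      max_le (by linarith [le_max_left (r - 2 * ρ) 0]) (by linarith [le_max_right (r - 2 * ρ) 0])
    simp only [hψ]
    nlinarith
  have hψcont : Continuous fun z : ℂ => ψ ‖z - y‖ := by fun_prop
  have hψ0 : ψ 0 = 0 := by simp [hψ, hρ.le]
  have hψx : ψ ‖x - y‖ < vanishTime M y s - vanishTime M x s := by
    have h₁ : max (‖x - y‖ - 2 * ρ) 0 = 0 := max_eq_right (by linarith)
    have h₂ : ε * (2 * ρ) = vanishTime M y s - vanishTime M x s :=
      div_mul_cancel₀ _ (by positivity)
    simp only [hψ, h₁]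
    nlinarith
  have hψR : T ≤ ψ (3 * ρ) := by
    have h₁ : max (3 * ρ - 2 * ρ) 0 = ρ := by rw [max_eq_left] <;> linarith
    have h₂ : K * ρ = T := div_mul_cancel₀ _ hρ.ne'
    simp only [hψ, h₁]
    nlinarith
  obtain ⟨w, hw, hmin⟩ := LowerSemicontinuousOn.exists_isMinOn
    (s := closedBall y (3 * ρ)) (f := fun z => vanishTime M z s + ψ ‖z - y‖)
    ⟨y, mem_closedBall_self (by linarith)⟩ (isCompact_closedBall _ _)
    (((lowerSemicontinuousOn_vanishTime hRF.opn hRF.sub).mono hslice).add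
      (hψcont.lowerSemicontinuous.lowerSemicontinuousOn _))
  have hwnorm : ‖w - y‖ ≤ 3 * ρ := by simpa [dist_eq_norm] using hw
  have hyT := vanishTime_le hRF.sub (hslice (mem_closedBall_self (by linarith : 0 ≤ 3 * ρ)))
  have hwx : vanishTime M w s + ψ ‖w - y‖ ≤ vanishTime M x s + ψ ‖x - y‖ :=
    hmin (show x ∈ closedBall y (3 * ρ) by rw [mem_closedBall, dist_eq_norm]; linarith)
  have hws := self_lt_vanishTime hRF.opn hRF.sub (hslice hw)
  have hspos : 0 < s := (hRF.sub (hslice hw)).1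
  have hψw : 0 ≤ ψ ‖w - y‖ := hψ0 ▸ hψmono.monotone (norm_nonneg _)
  refine hRF.not_exists_radial_touching hcomp hslice (w := w) ?_ ?_ (by linarith)
    (add_pos hεpos hKpos) hψmono hψlip fun z hz => hmin hz
  · rintro rfl
    linarith
  · refine lt_of_le_of_ne hwnorm fun h => ?_
    rw [h] at hwx
    linarith

/-- The vanishing time is constant on connected subsets of a time-slice. -/
theorem vanishTime_const_on_connected
    (T : ℝ) (hT : 0 < T) (M : Set (ℂ × ℝ)) (u : ℂ → ℝ → ℝ)
    (hRF : ConfRFS T M u) (hcomp : ConfRFSComplete T M u)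
    (s : ℝ) (hs : s ∈ Ioo (0:ℝ) T)
    (U : Set ℂ) (hU : U ⊆ timeSlice M s) (hUconn : IsPreconnected U) :
    ∀ x ∈ U, ∀ y ∈ U, vanishTime M x s = vanishTime M y s := by
  intro x hx y hy
  refine hUconn.induction₂ (fun x y => vanishTime M x s = vanishTime M y s) (fun p hp => ?_)
    (fun _ _ _ _ _ _ => Eq.trans) (fun _ _ _ _ => Eq.symm) hx hy
  have hopen : IsOpen (timeSlice M s) := hRF.opn.preimage (by fun_prop)
  obtain ⟨δ, hδ, hball⟩ := Metric.nhds_basis_closedBall.mem_iff.1 (hopen.mem_nhds (hU hp))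
  have hball' : closedBall p (4 * (δ / 4)) ⊆ timeSlice M s := by
    rwa [mul_div_cancel₀ δ four_ne_zero]
  have hpos : 0 < δ / 4 := by positivity
  filter_upwards [mem_nhdsWithin_of_mem_nhds (ball_mem_nhds p hpos)] with z hz
  exact le_antisymm
    (hRF.vanishTime_le_of_mem_ball hT hcomp hball' hz (mem_ball_self hpos))
    (hRF.vanishTime_le_of_mem_ball hT hcomp hball' (mem_ball_self hpos) hz)
end

section
/- (Isolated punctures are never filled in.) Let T > 0 and let (𝓜, u) be a conformal Ricci flow spacetime in the ambient space ℂ × (0,T) which is complete, expanding and continuous. Fix s ∈ (0,T) and suppose x ∈ ℂ satisfies x ∉ 𝓜_s but there exists ρ > 0 with B(x,ρ) \ {x} ⊆ 𝓜_s (i.e. x is an isolated point of the complement of 𝓜_s). Then (x,t) ∉ 𝓜 for every t ∈ (0,T). -/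
open Set MeasureTheory Filter Metric

/-- Isolated punctures are never filled in. -/
theorem isolated_puncture_never_filled
    (T : ℝ) (hT : 0 < T) (M : Set (ℂ × ℝ)) (u : ℂ → ℝ → ℝ)
    (hRF : ConfRFS T M u) (hcomp : ConfRFSComplete T M u)
    (hexp : Expanding T M) (hcts : ContinuousSpacetime T M)
    (s : ℝ) (hs : s ∈ Ioo (0:ℝ) T)
    (x : ℂ) (hx : x ∉ timeSlice M s)
    (ρ : ℝ) (hρ : 0 < ρ) (hball : Metric.ball x ρ \ {x} ⊆ timeSlice M s) :
    ∀ t ∈ Ioo (0:ℝ) T, (x, t) ∉ M := by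
  intro t ht hxt
  set S : Set ℝ := {r | (x, r) ∈ M}
  have hlb : ∀ r ∈ S, s ≤ r := fun r hr => by
    by_contra! h
    exact hx (hexp x r s hr h.le hs.2)
  have hbdd : BddBelow S := ⟨s, hlb⟩
  have hsc : s ≤ sInf S := le_csInf ⟨t, hxt⟩ hlb
  have hcT : sInf S < T := (csInf_le hbdd hxt).trans_lt ht.2
  -- the filling time lies in `S` by continuity of the spacetime
  have hmem : sInf S ∈ S := by
    change x ∈ timeSlice M (sInf S)
    rw [hcts (sInf S) ⟨hs.1.trans_le hsc, hcT⟩, mem_interior]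
    refine ⟨ball x ρ, fun z hz => mem_iInter₂.2 fun r hr => ?_, isOpen_ball, mem_ball_self hρ⟩
    by_cases hzx : z = x
    · subst hzx
      obtain ⟨r', hr', hlt⟩ := exists_lt_of_csInf_lt ⟨t, hxt⟩ hr.1
      exact hexp z r' r hr' hlt.le hr.2
    · exact hexp z s r (hball ⟨hz, hzx⟩) (hsc.trans hr.1.le) hr.2
  -- and cannot lie in `S`, which is open
  have hopen : IsOpen S := hRF.opn.preimage (by fun_prop : Continuous fun r : ℝ => (x, r))
  obtain ⟨ε, hε, hsub⟩ := Metric.isOpen_iff.1 hopen _ hmem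
  have hlow : sInf S - ε / 2 ∈ S := hsub (by
    rw [mem_ball, Real.dist_eq, sub_sub_cancel_left, abs_neg, abs_of_pos (half_pos hε)]
    exact half_lt_self hε)
  linarith [csInf_le hbdd hlow]
end

section
/- Let T > 0 and let (𝓜, u) be a conformal Ricci flow spacetime in the ambient space ℂ × (0,T) which is complete, expanding and continuous. Then for any times 0 < t₁ < t₂ < T, the set 𝓜_{t₂} \ 𝓜_{t₁} contains no isolated points: every x ∈ 𝓜_{t₂} \ 𝓜_{t₁} is an accumulation point of 𝓜_{t₂} \ 𝓜_{t₁} in ℂ. -/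
open Set MeasureTheory Filter Metric

/-- In a complete, expanding, continuous spacetime, `M_{t₂} \ M_{t₁}` contains no
isolated points. -/
theorem no_isolated_points_in_difference
    (T : ℝ) (hT : 0 < T) (M : Set (ℂ × ℝ)) (u : ℂ → ℝ → ℝ)
    (hRF : ConfRFS T M u) (hcomp : ConfRFSComplete T M u)
    (hexp : Expanding T M) (hcts : ContinuousSpacetime T M)
    (t₁ t₂ : ℝ) (h₁ : 0 < t₁) (h₁₂ : t₁ < t₂) (h₂ : t₂ < T) :
    ∀ x ∈ timeSlice M t₂ \ timeSlice M t₁,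
      x ∈ closure ((timeSlice M t₂ \ timeSlice M t₁) \ {x}) := by
  intro x ⟨hx₂, hx₁⟩
  by_contra hcl
  set S : Set ℝ := {t | (x, t) ∈ M}
  have hlb : ∀ t ∈ S, t₁ ≤ t := fun t ht ↦
    le_of_not_ge fun h ↦ hx₁ (hexp x t t₁ ht h (h₁₂.trans h₂))
  have hbdd : BddBelow S := ⟨t₁, hlb⟩
  have hne : S.Nonempty := ⟨t₂, hx₂⟩
  set s := sInf S
  have hs₁ : t₁ ≤ s := le_csInf hne hlb
  have hs₂ : s ≤ t₂ := csInf_le hbdd hx₂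
  have hSopen : IsOpen S := hRF.opn.preimage (by fun_prop : Continuous fun t : ℝ ↦ (x, t))
  have hslice : IsOpen (timeSlice M t₂) :=
    hRF.opn.preimage (by fun_prop : Continuous fun z : ℂ ↦ (z, t₂))
  -- Near `x`, every point other than `x` already lies in the slice at time `t₁`.
  have hxs : s ∈ S := by
    change x ∈ timeSlice M s
    rw [hcts s ⟨h₁.trans_le hs₁, hs₂.trans_lt h₂⟩, mem_interior_iff_mem_nhds]
    filter_upwards [isClosed_closure.isOpen_compl.mem_nhds hcl, hslice.mem_nhds hx₂]
      with z hz hz₂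
    refine mem_iInter₂.2 fun t ht ↦ ?_
    by_cases hzx : z = x
    · obtain ⟨r, hr, hrt⟩ := exists_lt_of_csInf_lt hne ht.1
      exact hzx ▸ hexp x r t hr hrt.le ht.2
    · have hz₁ : z ∈ timeSlice M t₁ := by
        by_contra h
        exact hz (subset_closure ⟨⟨hz₂, h⟩, hzx⟩)
      exact hexp z t₁ t hz₁ (hs₁.trans ht.1.le) ht.2
  have hnear : ∀ᶠ r in nhdsWithin s (Iio s), r ∈ S :=
    mem_nhdsWithin_of_mem_nhds (hSopen.mem_nhds hxs)
  obtain ⟨r, hrs, hr⟩ := (hnear.and self_mem_nhdsWithin).exists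
  exact absurd (csInf_le hbdd hrs) (not_le.2 hr)
end

section
/- (Connectedness by chains of time-preserving paths.) Let T > 0 and let 𝓜 ⊆ ℂ × (0,T) be a connected open subset. Then for any two points (x,t), (x′,t′) ∈ 𝓜 there exist m ∈ ℕ, points (x₀,s₀), …, (x_m,s_m) ∈ 𝓜 and (y₁,τ₁), …, (y_m,τ_m) ∈ 𝓜 with (x₀,s₀) = (x,t) and (x_m,s_m) = (x′,t′), and for each i ∈ {1,…,m} continuous maps η_i : [s_{i−1}, τ_i] → ℂ and γ_i : [s_i, τ_i] → ℂ such that (η_i(r),r) ∈ 𝓜 for all r ∈ [s_{i−1},τ_i], (γ_i(r),r) ∈ 𝓜 for all r ∈ [s_i,τ_i], η_i(s_{i−1}) = x_{i−1}, η_i(τ_i) = y_i, γ_i(s_i) = x_i, and γ_i(τ_i) = y_i. -/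
open Set MeasureTheory Filter Metric

/-- There is a time-preserving path in `M` from `a` forward in time to `b`. -/
def TimePreservingJoined (M : Set (ℂ × ℝ)) (a b : ℂ × ℝ) : Prop :=
  a.2 ≤ b.2 ∧ ∃ γ : ℝ → ℂ, ContinuousOn γ (Icc a.2 b.2) ∧
    (∀ r ∈ Icc a.2 b.2, (γ r, r) ∈ M) ∧ γ a.2 = a.1 ∧ γ b.2 = b.1

/-- The points `a` and `b` have a common future point in `M`. -/
def CommonFuture (M : Set (ℂ × ℝ)) (a b : ℂ × ℝ) : Prop :=
  ∃ c, TimePreservingJoined M a c ∧ TimePreservingJoined M b c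

lemma TimePreservingJoined.left_mem {M : Set (ℂ × ℝ)} {a b : ℂ × ℝ}
    (h : TimePreservingJoined M a b) : a ∈ M := by
  obtain ⟨hab, γ, -, hγ, ha, -⟩ := h
  simpa [ha] using hγ a.2 ⟨le_rfl, hab⟩

lemma TimePreservingJoined.right_mem {M : Set (ℂ × ℝ)} {a b : ℂ × ℝ}
    (h : TimePreservingJoined M a b) : b ∈ M := by
  obtain ⟨hab, γ, -, hγ, -, hb⟩ := h
  simpa [hb] using hγ b.2 ⟨hab, le_rfl⟩

lemma CommonFuture.symm {M : Set (ℂ × ℝ)} {a b : ℂ × ℝ} (h : CommonFuture M a b) :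
    CommonFuture M b a :=
  let ⟨c, hac, hbc⟩ := h
  ⟨c, hbc, hac⟩

/-- In a convex set, strictly time-ordered points are joined by a segment. -/
lemma Convex.timePreservingJoined {M U : Set (ℂ × ℝ)} (hU : Convex ℝ U) (hUM : U ⊆ M)
    {a b : ℂ × ℝ} (ha : a ∈ U) (hb : b ∈ U) (hab : a.2 < b.2) :
    TimePreservingJoined M a b := by
  have hd : b.2 - a.2 ≠ 0 := (sub_pos.2 hab).ne'
  refine ⟨hab.le, fun r => AffineMap.lineMap a.1 b.1 ((r - a.2) / (b.2 - a.2)), ?_, ?_, ?_, ?_⟩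
  · exact (AffineMap.lineMap_continuous.comp (by fun_prop)).continuousOn
  · intro r hr
    have h0 : 0 ≤ (r - a.2) / (b.2 - a.2) := div_nonneg (sub_nonneg.2 hr.1) (sub_pos.2 hab).le
    have h1 : (r - a.2) / (b.2 - a.2) ≤ 1 := (div_le_one (sub_pos.2 hab)).2 (by linarith [hr.2])
    have hmem := hU.lineMap_mem ha hb ⟨h0, h1⟩
    have heq : AffineMap.lineMap a b ((r - a.2) / (b.2 - a.2)) =
        (AffineMap.lineMap a.1 b.1 ((r - a.2) / (b.2 - a.2)), r) := by
      ext1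
      · simp [AffineMap.lineMap_apply]
      · simp [AffineMap.lineMap_apply, div_mul_cancel₀ _ hd]
    exact hUM (heq ▸ hmem)
  · simp
  · simp [div_self hd]

lemma IsOpen.eventually_commonFuture {M : Set (ℂ × ℝ)} (hM : IsOpen M) {p : ℂ × ℝ}
    (hp : p ∈ M) : ∀ᶠ q in nhds p, CommonFuture M p q := by
  obtain ⟨ε, hε, hεM⟩ := Metric.isOpen_iff.1 hM p hp
  have hc : (p.1, p.2 + ε / 2) ∈ ball p ε := by
    rw [mem_ball, Prod.dist_eq]
    simp [abs_of_pos hε, hε]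
  have joined {q : ℂ × ℝ} (hq : q ∈ ball p (ε / 2)) :
      TimePreservingJoined M q (p.1, p.2 + ε / 2) := by
    refine (convex_ball p ε).timePreservingJoined hεM
      (ball_subset_ball (half_le_self hε.le) hq) hc ?_
    rw [mem_ball, Prod.dist_eq, max_lt_iff, Real.dist_eq] at hq
    linarith [le_abs_self (q.2 - p.2)]
  filter_upwards [ball_mem_nhds p (half_pos hε)] with q hq
  exact ⟨_, joined (mem_ball_self (half_pos hε)), joined hq⟩

lemma IsPreconnected.reflTransGen_commonFuture {M : Set (ℂ × ℝ)} (hM : IsOpen M)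
    (hconn : IsPreconnected M) {p q : ℂ × ℝ} (hp : p ∈ M) (hq : q ∈ M) :
    Relation.ReflTransGen (CommonFuture M) p q := by
  have : Std.Symm (CommonFuture M) := ⟨fun _ _ => CommonFuture.symm⟩
  refine hconn.induction₂ (Relation.ReflTransGen (CommonFuture M)) (fun x hx => ?_)
    (fun _ _ _ _ _ _ h₁ h₂ => h₁.trans h₂)
    (fun _ _ _ _ h => Relation.ReflTransGen.stdSymm.symm _ _ h) hp hq
  exact nhdsWithin_le_nhds ((hM.eventually_commonFuture hx).mono fun _ => .single)

lemma Relation.ReflTransGen.exists_fin_chain {α : Type*} {r : α → α → Prop} {a b : α}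
    (h : Relation.ReflTransGen r a b) :
    ∃ (m : ℕ) (P : Fin (m + 1) → α), P 0 = a ∧ P (Fin.last m) = b ∧
      ∀ i : Fin m, r (P i.castSucc) (P i.succ) := by
  induction h using Relation.ReflTransGen.head_induction_on with
  | refl => exact ⟨0, fun _ => b, rfl, rfl, fun i => i.elim0⟩
  | @head a c hac _ ih =>
    obtain ⟨m, P, h0, hl, hP⟩ := ih
    refine ⟨m + 1, Fin.cons a P, rfl, by simpa [← Fin.succ_last] using hl, fun i => ?_⟩
    induction i using Fin.cases with
    | zero => simpa [h0] using hac
    | succ i => simpa [← Fin.succ_castSucc] using hP i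

/-- Any two points of a connected open subset of `ℂ × (0,T)` are joined by a
finite chain of time-preserving paths with alternating orientations. -/
theorem connected_by_chains_of_time_preserving_paths
    (T : ℝ) (hT : 0 < T) (M : Set (ℂ × ℝ))
    (hsub : M ⊆ {p : ℂ × ℝ | p.2 ∈ Ioo 0 T})
    (hopen : IsOpen M) (hconn : IsConnected M) :
    ∀ p ∈ M, ∀ q ∈ M,
      ∃ (m : ℕ) (P : Fin (m + 1) → ℂ × ℝ) (Q : Fin m → ℂ × ℝ)
        (η γ : Fin m → ℝ → ℂ),
        (∀ i, P i ∈ M) ∧ (∀ i, Q i ∈ M) ∧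
        P 0 = p ∧ P (Fin.last m) = q ∧
        ∀ i : Fin m,
          (P i.castSucc).2 ≤ (Q i).2 ∧ (P i.succ).2 ≤ (Q i).2 ∧
          ContinuousOn (η i) (Icc (P i.castSucc).2 (Q i).2) ∧
          (∀ r ∈ Icc (P i.castSucc).2 (Q i).2, (η i r, r) ∈ M) ∧
          η i (P i.castSucc).2 = (P i.castSucc).1 ∧ η i (Q i).2 = (Q i).1 ∧
          ContinuousOn (γ i) (Icc (P i.succ).2 (Q i).2) ∧
          (∀ r ∈ Icc (P i.succ).2 (Q i).2, (γ i r, r) ∈ M) ∧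
          γ i (P i.succ).2 = (P i.succ).1 ∧ γ i (Q i).2 = (Q i).1 := by
  intro p hp q hq
  obtain ⟨m, P, h0, hl, hP⟩ :=
    (hconn.isPreconnected.reflTransGen_commonFuture hopen hp hq).exists_fin_chain
  choose Q hQ hQ' using hP
  have hPM : ∀ i, P i ∈ M := fun i => by
    induction i using Fin.lastCases with
    | last => exact hl ▸ hq
    | cast i => exact (hQ i).left_mem
  have hQM : ∀ i, Q i ∈ M := fun i => (hQ i).right_mem
  choose hle η hηc hηM hη₀ hη₁ using hQ
  choose hle' γ hγc hγM hγ₀ hγ₁ using hQ'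
  exact ⟨m, P, Q, η, γ, hPM, hQM, h0, hl, fun i => ⟨hle i, hle' i, hηc i, hηM i, hη₀ i, hη₁ i,
    hγc i, hγM i, hγ₀ i, hγ₁ i⟩⟩
end
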